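/- Let s and b be facets with s contained in the closure of b, and let r ∈ R. If r takes an integer value at some point of b, then r is constant on b ∪ s: for every p ∈ s and q, q' ∈ b one has r(p) = r(q) = r(q'). In particular, if (b,r) ∈ ℤ then (s,r) = (b,r). -/

import Mathlib

open Set

/-- The set of affine roots `(r, n)` with `r ∈ R`, `n : ℤ`, vanishing at the point `x`,
i.e. such that `r x + n = 0`.  This is the set `Y_x`. -/
def affineRootsVanishingAt {V : Type*} [NormedAddCommGroup V] [NormedSpace ℝ V]
    (R : Finset (V →ₗ[ℝ] ℝ)) (x : V) : Set ((V →ₗ[ℝ] ℝ) × ℤ) :=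
  {α | α.1 ∈ R ∧ α.1 x + (α.2 : ℝ) = 0}

/-- `H_n`: the set of points where exactly `n` affine roots vanish. -/
def Hset {V : Type*} [NormedAddCommGroup V] [NormedSpace ℝ V]
    (R : Finset (V →ₗ[ℝ] ℝ)) (n : ℕ) : Set V :=
  {x | (affineRootsVanishingAt R x).ncard = n}

/-- A facet is a connected component of some `H_n`. -/
def IsFacet {V : Type*} [NormedAddCommGroup V] [NormedSpace ℝ V]
    (R : Finset (V →ₗ[ℝ] ℝ)) (σ : Set V) : Prop :=
  ∃ (n : ℕ) (x : V), x ∈ Hset R n ∧ σ = connectedComponentIn (Hset R n) x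

theorem affineRootsVanishingAt_finite {V : Type*} [NormedAddCommGroup V] [NormedSpace ℝ V]
    (R : Finset (V →ₗ[ℝ] ℝ)) (x : V) : (affineRootsVanishingAt R x).Finite := by
  refine Set.Finite.of_finite_image (f := Prod.fst) (R.finite_toSet.subset ?_) ?_
  · rintro _ ⟨α, hα, rfl⟩
    exact hα.1
  · rintro ⟨r, m⟩ ⟨_, hm⟩ ⟨r', n⟩ ⟨_, hn⟩ (rfl : r = r')
    have : (m : ℝ) = n := add_left_cancel (hm.trans hn.symm)
    rw [Int.cast_injective this]

/-- Passing to a nearby point cannot create new vanishing affine roots. -/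
theorem eventually_affineRootsVanishingAt_subset {V : Type*} [NormedAddCommGroup V]
    [NormedSpace ℝ V] [FiniteDimensional ℝ V] (R : Finset (V →ₗ[ℝ] ℝ)) (x : V) :
    ∀ᶠ y in nhds x, affineRootsVanishingAt R y ⊆ affineRootsVanishingAt R x := by
  have key : ∀ r ∈ R, ∀ᶠ y in nhds x, ∀ n : ℤ, r y + n = 0 → r x + n = 0 := by
    intro r _
    have hclosed : IsClosed (((↑) : ℤ → ℝ) '' {n | r x + n ≠ 0}) :=
      Int.isClosedEmbedding_coe_real.isClosedMap _ (isClosed_discrete _)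
    have hx : -r x ∈ (((↑) : ℤ → ℝ) '' {n | r x + n ≠ 0})ᶜ := by
      rintro ⟨n, hn, h⟩
      exact hn (by rw [h]; ring)
    have hcont : Continuous fun y => -r y := r.continuous_of_finiteDimensional.neg
    filter_upwards [hcont.continuousAt.eventually (hclosed.isOpen_compl.mem_nhds hx)]
      with y hy n hn
    by_contra hne
    exact hy ⟨n, hne, by linarith⟩
  filter_upwards [(Filter.eventually_all_finset R).2 key] with y hy α hα
  exact ⟨hα.1, hy α.1 hα.1 α.2 hα.2⟩

/-- The set of vanishing affine roots is constant on each preconnected subset of `H_n`. -/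
theorem affineRootsVanishingAt_eq_of_isPreconnected {V : Type*} [NormedAddCommGroup V]
    [NormedSpace ℝ V] [FiniteDimensional ℝ V] {R : Finset (V →ₗ[ℝ] ℝ)} {n : ℕ} {t : Set V}
    (ht : IsPreconnected t) (htn : t ⊆ Hset R n) {x y : V} (hx : x ∈ t) (hy : y ∈ t) :
    affineRootsVanishingAt R x = affineRootsVanishingAt R y := by
  refine ht.induction₂ (fun x y => affineRootsVanishingAt R x = affineRootsVanishingAt R y)
    (fun x hx => ?_) (fun _ _ _ _ _ _ => Eq.trans) (fun _ _ _ _ => Eq.symm) hx hy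
  filter_upwards [(eventually_affineRootsVanishingAt_subset R x).filter_mono nhdsWithin_le_nhds,
    self_mem_nhdsWithin] with y hsub hy
  refine (Set.eq_of_subset_of_ncard_le hsub ?_ (affineRootsVanishingAt_finite R x)).symm
  exact ((htn hx : _ = n).trans (htn hy : _ = n).symm).le

theorem root_integer_value_rigid_on_facet_closure {V : Type*} [NormedAddCommGroup V] [NormedSpace ℝ V] [FiniteDimensional ℝ V]
    (R : Finset (V →ₗ[ℝ] ℝ)) (hR : ∀ r ∈ R, r ≠ 0)
    (s b : Set V) (hs : IsFacet R s) (hb : IsFacet R b) (hsb : s ⊆ closure b)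
    (r : V →ₗ[ℝ] ℝ) (hr : r ∈ R) (hint : ∃ q ∈ b, ∃ m : ℤ, r q = m) :
    ∀ p ∈ s, ∀ q ∈ b, ∀ q' ∈ b, r p = r q ∧ r q = r q' := by
  obtain ⟨n, x, -, rfl⟩ := hb
  obtain ⟨q₀, hq₀, m, hm⟩ := hint
  have hconst : ∀ q ∈ connectedComponentIn (Hset R n) x, r q = m := by
    intro q hq
    have hmem : (r, -m) ∈ affineRootsVanishingAt R q₀ := ⟨hr, by simp [hm]⟩
    rw [affineRootsVanishingAt_eq_of_isPreconnected isPreconnected_connectedComponentIn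
      (connectedComponentIn_subset _ _) hq₀ hq] at hmem
    have h := hmem.2
    push_cast at h
    linarith
  have hclosure : closure (connectedComponentIn (Hset R n) x) ⊆ {p | r p = m} :=
    closure_minimal hconst (isClosed_eq r.continuous_of_finiteDimensional continuous_const)
  intro p hp q hq q' hq'
  exact ⟨(hclosure (hsb hp)).trans (hconst q hq).symm, (hconst q hq).trans (hconst q' hq').symm⟩
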